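/- Let μ₁, ν₁, μ₂, ν₂ ∈ (0, 1] with μ₁ν₂ − ν₁μ₂ > 0. Let (X^{(1)}_i, c^{(1)}_i)_{i=1}^n and (X^{(2)}_i, c^{(2)}_i)_{i=1}^n be two mutually independent i.i.d. sequences of random pairs with, almost surely, 0 ≤ X^{(k)}_i ≤ 1 and 0 < c^{(k)}_i ≤ 1, and with 𝔼[X^{(k)}_1] = μ_k and 𝔼[c^{(k)}_1] = ν_k for k = 1, 2. Denote by X̄_k = (1/n) Σ_i X^{(k)}_i and c̄_k = (1/n) Σ_i c^{(k)}_i the sample means. Then ℙ[X̄₁ / c̄₁ ≤ X̄₂ / c̄₂] ≤ 2 exp(−2 n Ξ²), where Ξ = (μ₁ν₂ − ν₁μ₂)/(μ₁ + μ₂ + ν₁ + ν₂). -/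

import Mathlib

open Real MeasureTheory ProbabilityTheory

lemma hoeffding_aux {Ω : Type*} [MeasureSpace Ω] [IsProbabilityMeasure (ℙ : Measure Ω)]
    (n : ℕ) (hn : 0 < n) (Y : Fin n → Ω → ℝ) (hm : ∀ i, Measurable (Y i))
    (hI : iIndepFun Y ℙ) (a b d : ℝ) (hab : a < b) (hd : 0 ≤ d)
    (hb : ∀ i, ∀ᵐ ω ∂ℙ, Y i ω ∈ Set.Icc a b) (hmean : ∀ i, ∫ ω, Y i ω ∂ℙ = -d) :
    (ℙ : Measure Ω) {ω | 0 ≤ ∑ i, Y i ω} ≤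
      ENNReal.ofReal (Real.exp (-2 * n * (d / (b - a)) ^ 2)) := by
  have hI' : iIndepFun (fun i ω => Y i ω + d) (ℙ : Measure Ω) :=
    hI.comp (fun _ x => x + d) (fun _ => by fun_prop)
  have hS : ∀ i ∈ (Finset.univ : Finset (Fin n)),
      HasSubgaussianMGF (fun ω => Y i ω + d) ((‖b - a‖₊ / 2) ^ 2) (ℙ : Measure Ω) := by
    intro i _
    have := hasSubgaussianMGF_of_mem_Icc (hm i).aemeasurable (hb i)
    simpa [hmean i] using this
  have hnd : 0 ≤ (n : ℝ) * d := by positivity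
  have h := HasSubgaussianMGF.measure_sum_ge_le_of_iIndepFun hI' hS hnd
  have hset : {ω | (n : ℝ) * d ≤ ∑ i, (Y i ω + d)} = {ω | 0 ≤ ∑ i, Y i ω} := by
    ext ω
    simp [Finset.sum_add_distrib]
  rw [hset] at h
  rw [← ofReal_measureReal]
  apply ENNReal.ofReal_le_ofReal
  refine h.trans (le_of_eq ?_)
  congr 1
  have hba : 0 < b - a := sub_pos.2 hab
  have hn' : (0 : ℝ) < n := by exact_mod_cast hn
  simp only [Finset.sum_const, Finset.card_univ, Fintype.card_fin, nsmul_eq_mul]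
  push_cast
  rw [Real.norm_of_nonneg hba.le]
  field_simp

/-- Two-arm comparison bound: with two mutually independent i.i.d. sequences of
reward–cost pairs (arm `0` and arm `1`), rewards in `[0,1]` a.s., costs in `(0,1]` a.s.,
means `μ k ∈ (0,1]`, `ν k ∈ (0,1]` with `μ 0 * ν 1 − ν 0 * μ 1 > 0`, the probability that
the empirical reward-to-cost ratio of arm `0` falls below that of arm `1` after `n` pulls
each is at most `2 exp(−2 n Ξ²)` where
`Ξ = (μ 0 ν 1 − ν 0 μ 1)/(μ 0 + μ 1 + ν 0 + ν 1)`. -/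
theorem two_arm_ratio_comparison_bound
    {Ω : Type*} [MeasureSpace Ω] [IsProbabilityMeasure (ℙ : Measure Ω)]
    (n : ℕ) (hn : 0 < n) (X c : Fin 2 → Fin n → Ω → ℝ)
    (hXmeas : ∀ k i, Measurable (X k i)) (hcmeas : ∀ k i, Measurable (c k i))
    (hindep : iIndepFun
      (fun p : Fin 2 × Fin n => fun ω => (X p.1 p.2 ω, c p.1 p.2 ω)) ℙ)
    (hident : ∀ k i, Measure.map (fun ω => (X k i ω, c k i ω)) ℙ =
      Measure.map (fun ω => (X k ⟨0, hn⟩ ω, c k ⟨0, hn⟩ ω)) ℙ)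
    (hXbdd : ∀ k i, ∀ᵐ ω ∂ℙ, 0 ≤ X k i ω ∧ X k i ω ≤ 1)
    (hcbdd : ∀ k i, ∀ᵐ ω ∂ℙ, 0 < c k i ω ∧ c k i ω ≤ 1)
    (μ ν : Fin 2 → ℝ)
    (hμ : ∀ k, μ k = ∫ ω, X k ⟨0, hn⟩ ω ∂ℙ) (hν : ∀ k, ν k = ∫ ω, c k ⟨0, hn⟩ ω ∂ℙ)
    (hμmem : ∀ k, 0 < μ k ∧ μ k ≤ 1) (hνmem : ∀ k, 0 < ν k ∧ ν k ≤ 1)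
    (hgap : 0 < μ 0 * ν 1 - ν 0 * μ 1) :
    ℙ {ω | ((1 / (n : ℝ)) * ∑ i, X 0 i ω) / ((1 / (n : ℝ)) * ∑ i, c 0 i ω) ≤
           ((1 / (n : ℝ)) * ∑ i, X 1 i ω) / ((1 / (n : ℝ)) * ∑ i, c 1 i ω)} ≤
      ENNReal.ofReal (2 * Real.exp (-2 * n *
        ((μ 0 * ν 1 - ν 0 * μ 1) / (μ 0 + μ 1 + ν 0 + ν 1)) ^ 2)) := by
  have hX1 : ∀ k i, ∫ ω, X k i ω ∂ℙ = μ k := by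
    intro k i
    have hid : IdentDistrib (fun ω => (X k i ω, c k i ω))
        (fun ω => (X k ⟨0, hn⟩ ω, c k ⟨0, hn⟩ ω)) ℙ ℙ :=
      ⟨((hXmeas k i).prodMk (hcmeas k i)).aemeasurable,
        ((hXmeas k _).prodMk (hcmeas k _)).aemeasurable, hident k i⟩
    rw [hμ k]
    exact (hid.comp measurable_fst).integral_eq
  have hc1 : ∀ k i, ∫ ω, c k i ω ∂ℙ = ν k := by
    intro k i
    have hid : IdentDistrib (fun ω => (X k i ω, c k i ω))
        (fun ω => (X k ⟨0, hn⟩ ω, c k ⟨0, hn⟩ ω)) ℙ ℙ :=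
      ⟨((hXmeas k i).prodMk (hcmeas k i)).aemeasurable,
        ((hXmeas k _).prodMk (hcmeas k _)).aemeasurable, hident k i⟩
    rw [hν k]
    exact (hid.comp measurable_snd).integral_eq
  have hXi : ∀ k i, Integrable (X k i) ℙ := fun k i =>
    Integrable.of_mem_Icc 0 1 (hXmeas k i).aemeasurable (hXbdd k i)
  have hci : ∀ k i, Integrable (c k i) ℙ := fun k i =>
    Integrable.of_mem_Icc 0 1 (hcmeas k i).aemeasurable
      ((hcbdd k i).mono fun ω h => ⟨h.1.le, h.2⟩)
  obtain ⟨hm0, -⟩ := hμmem 0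
  obtain ⟨hm1, -⟩ := hμmem 1
  obtain ⟨hv0, -⟩ := hνmem 0
  obtain ⟨hv1, -⟩ := hνmem 1
  obtain ⟨e, he⟩ : ∃ e, e = (μ 0 + μ 1) / (ν 0 + ν 1) := ⟨_, rfl⟩
  have he0 : 0 < e := by rw [he]; positivity
  obtain ⟨d, hd⟩ : ∃ d, d = (μ 0 * ν 1 - ν 0 * μ 1) / (ν 0 + ν 1) := ⟨_, rfl⟩
  have hd0 : 0 ≤ d := by rw [hd]; positivity
  have hXi' : d / (1 + e) = (μ 0 * ν 1 - ν 0 * μ 1) / (μ 0 + μ 1 + ν 0 + ν 1) := by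
    rw [hd, he]
    have h1 : ν 0 + ν 1 ≠ 0 := by positivity
    have h2 : μ 0 + μ 1 + ν 0 + ν 1 ≠ 0 := by positivity
    have h3 : 1 + (μ 0 + μ 1) / (ν 0 + ν 1) ≠ 0 := by positivity
    rw [div_div, mul_add, mul_div_cancel₀ _ h1]
    congr 1
    ring
  have hI : ∀ k, iIndepFun (fun i ω => (X k i ω, c k i ω)) (ℙ : Measure Ω) := fun k =>
    hindep.precomp (g := fun i : Fin n => (k, i)) (fun i j h => by simpa using h)
  have h0 := hoeffding_aux n hn (fun i ω => e * c 0 i ω - X 0 i ω)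
    (fun i => ((hcmeas 0 i).const_mul e).sub (hXmeas 0 i))
    ((hI 0).comp (fun _ p => e * p.2 - p.1) (fun _ => by fun_prop)) (-1) e d (by linarith) hd0
    (fun i => by
      filter_upwards [hXbdd 0 i, hcbdd 0 i] with ω h1 h2
      constructor <;> nlinarith [h1.1, h1.2, h2.1, h2.2])
    (fun i => by
      rw [integral_sub ((hci 0 i).const_mul e) (hXi 0 i), integral_const_mul, hX1, hc1, he, hd]
      field_simp
      ring)
  have h1 := hoeffding_aux n hn (fun i ω => X 1 i ω - e * c 1 i ω)
    (fun i => (hXmeas 1 i).sub ((hcmeas 1 i).const_mul e))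
    ((hI 1).comp (fun _ p => p.1 - e * p.2) (fun _ => by fun_prop)) (-e) 1 d (by linarith) hd0
    (fun i => by
      filter_upwards [hXbdd 1 i, hcbdd 1 i] with ω h1 h2
      constructor <;> nlinarith [h1.1, h1.2, h2.1, h2.2])
    (fun i => by
      rw [integral_sub (hXi 1 i) ((hci 1 i).const_mul e), integral_const_mul, hX1, hc1, he, hd]
      field_simp
      ring)
  rw [show e - -1 = 1 + e by ring, hXi'] at h0
  rw [show 1 - -e = 1 + e by ring, hXi'] at h1
  rw [two_mul, ENNReal.ofReal_add (Real.exp_pos _).le (Real.exp_pos _).le]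
  refine le_trans ?_ (add_le_add h0 h1)
  refine le_trans (measure_mono_ae ?_) (measure_union_le _ _)
  have hca : ∀ᵐ ω ∂ℙ, ∀ k i, 0 < c k i ω := by
    rw [ae_all_iff]; intro k
    rw [ae_all_iff]; intro i
    exact (hcbdd k i).mono fun ω h => h.1
  filter_upwards [hca] with ω hω h
  have hn' : (0 : ℝ) < 1 / n := by positivity
  have hne : (Finset.univ : Finset (Fin n)).Nonempty := ⟨⟨0, hn⟩, Finset.mem_univ _⟩
  have hs : ∀ k, 0 < ∑ i, c k i ω := fun k => Finset.sum_pos (fun i _ => hω k i) hne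
  change _ / _ ≤ _ / _ at h
  rw [mul_div_mul_left _ _ hn'.ne', mul_div_mul_left _ _ hn'.ne'] at h
  change (0 ≤ ∑ i, (e * c 0 i ω - X 0 i ω)) ∨ (0 ≤ ∑ i, (X 1 i ω - e * c 1 i ω))
  simp only [Finset.sum_sub_distrib, ← Finset.mul_sum, sub_nonneg]
  rcases le_total ((∑ i, X 0 i ω) / ∑ i, c 0 i ω) e with h' | h'
  · left
    exact (div_le_iff₀ (hs 0)).1 h'
  · right
    exact (le_div_iff₀ (hs 1)).1 (h'.trans h)
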